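/- Let P be a finite-dimensional Poisson algebra with solvable radical R and nilradical N. Then the annihilator of N in R is contained in N, i.e., Ann_R(N) = {x ∈ R : x·N = 0 and [x,N] = 0} ⊆ N. -/

import Mathlib

/-!  Framework: dialgebras and Poisson algebras as bilinear structures on a module. -/

variable {F P : Type*} [Field F] [AddCommGroup P] [Module F P]

/-- A dialgebra: a vector space with two bilinear multiplications. -/
structure Dialgebra (F P : Type*) [Field F] [AddCommGroup P] [Module F P] where
  mul : P →ₗ[F] P →ₗ[F] P
  bracket : P →ₗ[F] P →ₗ[F] P

namespace Dialgebra

variable (D : Dialgebra F P)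

/-- Span of the set of products `a·b`, `a ∈ A`, `b ∈ B`. -/
def pmul (A B : Submodule F P) : Submodule F P :=
  Submodule.span F (Set.image2 (fun a b => D.mul a b) (A : Set P) (B : Set P))

/-- Span of the set of brackets `[a,b]`, `a ∈ A`, `b ∈ B`. -/
def pbra (A B : Submodule F P) : Submodule F P :=
  Submodule.span F (Set.image2 (fun a b => D.bracket a b) (A : Set P) (B : Set P))

/-- `A·B + [A,B]`. -/
def psq (A B : Submodule F P) : Submodule F P := D.pmul A B ⊔ D.pbra A B

/-- A subalgebra: a subspace closed under both products. -/
def IsSubalgebra (A : Submodule F P) : Prop := D.psq A A ≤ A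

/-- An ideal of the dialgebra. -/
def IsIdeal (A : Submodule F P) : Prop :=
  D.pmul A ⊤ ≤ A ∧ D.pmul ⊤ A ≤ A ∧ D.pbra A ⊤ ≤ A ∧ D.pbra ⊤ A ≤ A

/-- `A` is an ideal of the subalgebra `U`. -/
def IsIdealIn (A U : Submodule F P) : Prop :=
  A ≤ U ∧ D.pmul A U ≤ A ∧ D.pmul U A ≤ A ∧ D.pbra A U ≤ A ∧ D.pbra U A ≤ A

/-- Lower central series of `B`: `B^1 = B`, `B^{n+1} = B^n·B + [B^n,B]`. -/
def lcs (B : Submodule F P) : ℕ → Submodule F P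
  | 0 => B
  | n + 1 => D.psq (lcs B n) B

/-- `B` is nilpotent as a dialgebra. -/
def IsNilpotentSub (B : Submodule F P) : Prop := ∃ n, D.lcs B n = ⊥

/-- Derived series of `B`. -/
def ders (B : Submodule F P) : ℕ → Submodule F P
  | 0 => B
  | n + 1 => D.psq (ders B n) (ders B n)

/-- `B` is solvable as a dialgebra. -/
def IsSolvableSub (B : Submodule F P) : Prop := ∃ n, D.ders B n = ⊥

/-- Associative powers: `apow B n = B_A^{n+1}`, i.e. `apow B 0 = B_A^1 = B`. -/
def apow (B : Submodule F P) : ℕ → Submodule F P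
  | 0 => B
  | n + 1 => D.pmul (apow B n) B

/-- Lie powers: `lpow B n = B_L^{n+1}`. -/
def lpow (B : Submodule F P) : ℕ → Submodule F P
  | 0 => B
  | n + 1 => D.pbra (lpow B n) B

/-- Associative nilpotency of `B`. -/
def AssocNilpotent (B : Submodule F P) : Prop := ∃ n, D.apow B n = ⊥

/-- Lie nilpotency of `B`. -/
def LieNilpotent (B : Submodule F P) : Prop := ∃ n, D.lpow B n = ⊥

/-- `mulPows B X n = X·B_A^n` (with the convention that it is `X` for `n = 0`). -/
def mulPows (B X : Submodule F P) : ℕ → Submodule F P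
  | 0 => X
  | n + 1 => D.pmul (mulPows B X n) B

/-- `M` is a maximal (proper) subalgebra of the subalgebra `U`. -/
def IsMaximalSubalgebraIn (U M : Submodule F P) : Prop :=
  D.IsSubalgebra M ∧ M < U ∧ ∀ K, D.IsSubalgebra K → M ≤ K → K ≤ U → K = M ∨ K = U

/-- Frattini subalgebra of the subalgebra `U`: intersection of its maximal subalgebras. -/
def frattiniIn (U : Submodule F P) : Submodule F P :=
  U ⊓ sInf {M | D.IsMaximalSubalgebraIn U M}

/-- Frattini ideal of the subalgebra `U`: largest ideal of `U` inside `frattiniIn U`. -/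
def phiIn (U : Submodule F P) : Submodule F P :=
  sSup {I | D.IsIdealIn I U ∧ I ≤ D.frattiniIn U}

/-- Frattini subalgebra of the dialgebra. -/
def frattini : Submodule F P := D.frattiniIn ⊤

/-- Frattini ideal of the dialgebra. -/
def phi : Submodule F P := sSup {I | D.IsIdeal I ∧ I ≤ D.frattini}

/-- Minimal ideal. -/
def IsMinimalIdeal (A : Submodule F P) : Prop :=
  D.IsIdeal A ∧ A ≠ ⊥ ∧ ∀ I, D.IsIdeal I → I ≤ A → I = ⊥ ∨ I = A

/-- Zero (trivial-multiplication) subspace. -/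
def IsZeroAlg (A : Submodule F P) : Prop := D.pmul A A = ⊥ ∧ D.pbra A A = ⊥

/-- Zero socle: sum of the minimal zero ideals. -/
def zsoc : Submodule F P := sSup {A | D.IsMinimalIdeal A ∧ D.IsZeroAlg A}

/-- Socle: sum of the minimal ideals. -/
def soc : Submodule F P := sSup {A | D.IsMinimalIdeal A}

/-- Annihilator of `B` in the algebra. -/
def annih (B : Submodule F P) : Submodule F P where
  carrier := {x | ∀ b ∈ B, D.mul x b = 0 ∧ D.bracket x b = 0}
  add_mem' := by
    intro x y hx hy b hb
    have h1 := hx b hb; have h2 := hy b hb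
    constructor <;> simp [map_add, LinearMap.add_apply, h1.1, h1.2, h2.1, h2.2]
  zero_mem' := by intro b hb; simp
  smul_mem' := by
    intro c x hx b hb
    have h := hx b hb
    constructor <;> simp [map_smul, LinearMap.smul_apply, h.1, h.2]

/-- `R` is the solvable radical: the largest solvable ideal. -/
def IsRadical (R : Submodule F P) : Prop :=
  D.IsIdeal R ∧ D.IsSolvableSub R ∧ ∀ I, D.IsIdeal I → D.IsSolvableSub I → I ≤ R

/-- `N` is the nilradical: the largest nilpotent ideal. -/
def IsNilradical (N : Submodule F P) : Prop :=
  D.IsIdeal N ∧ D.IsNilpotentSub N ∧ ∀ I, D.IsIdeal I → D.IsNilpotentSub I → I ≤ N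

end Dialgebra

/-- A Poisson algebra: commutative associative product and Lie bracket linked by the Leibniz rule. -/
structure PoissonAlgebra (F P : Type*) [Field F] [AddCommGroup P] [Module F P]
    extends Dialgebra F P where
  mul_comm : ∀ x y, mul x y = mul y x
  mul_assoc : ∀ x y z, mul (mul x y) z = mul x (mul y z)
  lie_self : ∀ x, bracket x x = 0
  leibniz_lie : ∀ x y z, bracket x (bracket y z) = bracket (bracket x y) z + bracket y (bracket x z)
  leibniz : ∀ x y z, bracket (mul x y) z = mul (bracket x z) y + mul x (bracket y z)
namespace Dialgebra

variable {D : Dialgebra F P} {A B C E I : Submodule F P}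

theorem pmul_le : D.pmul A B ≤ C ↔ ∀ a ∈ A, ∀ b ∈ B, D.mul a b ∈ C := by
  rw [pmul, Submodule.span_le, Set.image2_subset_iff]
  rfl

theorem pbra_le : D.pbra A B ≤ C ↔ ∀ a ∈ A, ∀ b ∈ B, D.bracket a b ∈ C := by
  rw [pbra, Submodule.span_le, Set.image2_subset_iff]
  rfl

theorem psq_le : D.psq A B ≤ C ↔
    ∀ a ∈ A, ∀ b ∈ B, D.mul a b ∈ C ∧ D.bracket a b ∈ C := by
  rw [psq, sup_le_iff, pmul_le, pbra_le]
  exact ⟨fun h a ha b hb => ⟨h.1 a ha b hb, h.2 a ha b hb⟩,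
    fun h => ⟨fun a ha b hb => (h a ha b hb).1, fun a ha b hb => (h a ha b hb).2⟩⟩

theorem mul_mem_psq {a b : P} (ha : a ∈ A) (hb : b ∈ B) : D.mul a b ∈ D.psq A B :=
  (psq_le.1 le_rfl a ha b hb).1

theorem bracket_mem_psq {a b : P} (ha : a ∈ A) (hb : b ∈ B) : D.bracket a b ∈ D.psq A B :=
  (psq_le.1 le_rfl a ha b hb).2

theorem psq_mono (hAC : A ≤ C) (hBE : B ≤ E) : D.psq A B ≤ D.psq C E :=
  psq_le.2 fun _ ha _ hb =>
    ⟨mul_mem_psq (hAC ha) (hBE hb), bracket_mem_psq (hAC ha) (hBE hb)⟩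

theorem ders_mono (h : A ≤ B) (n : ℕ) : D.ders A n ≤ D.ders B n := by
  induction n with
  | zero => exact h
  | succ n ih => exact psq_mono ih ih

theorem IsIdeal.mul_mem (h : D.IsIdeal I) {a : P} (ha : a ∈ I) (p : P) : D.mul a p ∈ I :=
  pmul_le.1 h.1 a ha p trivial

theorem IsIdeal.bracket_mem (h : D.IsIdeal I) {a : P} (ha : a ∈ I) (p : P) :
    D.bracket a p ∈ I :=
  pbra_le.1 h.2.2.1 a ha p trivial

theorem IsIdeal.bracket_mem' (h : D.IsIdeal I) (p : P) {a : P} (ha : a ∈ I) :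
    D.bracket p a ∈ I :=
  pbra_le.1 h.2.2.2 p trivial a ha

theorem IsIdeal.mul_mem' (h : D.IsIdeal I) (p : P) {a : P} (ha : a ∈ I) : D.mul p a ∈ I :=
  pmul_le.1 h.2.1 p trivial a ha

theorem IsIdeal.psq_self_le (h : D.IsIdeal I) : D.psq I I ≤ I :=
  psq_le.2 fun _ ha b _ => ⟨h.mul_mem ha b, h.bracket_mem ha b⟩

theorem IsIdeal.ders_le (h : D.IsIdeal I) (n : ℕ) : D.ders I n ≤ I := by
  induction n with
  | zero => exact le_rfl
  | succ n ih => exact (psq_mono ih ih).trans h.psq_self_le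

end Dialgebra

namespace PoissonAlgebra

open Dialgebra

variable (Q : PoissonAlgebra F P) {I N : Submodule F P}

theorem bracket_skew (x y : P) : Q.bracket x y = -Q.bracket y x := by
  have h := Q.lie_self (x + y)
  simp only [map_add, LinearMap.add_apply, Q.lie_self, zero_add, add_zero] at h
  exact eq_neg_of_add_eq_zero_right h

theorem isIdeal_of_right (h : ∀ a ∈ I, ∀ p, Q.mul a p ∈ I ∧ Q.bracket a p ∈ I) :
    Q.IsIdeal I := by
  refine ⟨pmul_le.2 fun a ha p _ => (h a ha p).1, pmul_le.2 fun p _ a ha => ?_,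
    pbra_le.2 fun a ha p _ => (h a ha p).2, pbra_le.2 fun p _ a ha => ?_⟩
  · rw [Q.mul_comm]
    exact (h a ha p).1
  · rw [Q.bracket_skew]
    exact I.neg_mem (h a ha p).2

theorem leibniz_right (x y z : P) :
    Q.bracket x (Q.mul y z) = Q.mul (Q.bracket x y) z + Q.mul y (Q.bracket x z) := by
  rw [Q.bracket_skew, Q.leibniz, Q.bracket_skew y x, Q.bracket_skew z x]
  simp [add_comm]

theorem bracket_bracket (x y z : P) :
    Q.bracket (Q.bracket x y) z = Q.bracket x (Q.bracket y z) - Q.bracket y (Q.bracket x z) :=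
  eq_sub_of_add_eq (Q.leibniz_lie x y z).symm

theorem isIdeal_psq_self (h : Q.IsIdeal I) : Q.IsIdeal (Q.psq I I) := by
  refine Q.isIdeal_of_right fun c hc p => ?_
  suffices Q.psq I I ≤ (Q.psq I I).comap (Q.mul.flip p) ⊓ (Q.psq I I).comap (Q.bracket.flip p)
    from this hc
  refine psq_le.2 fun a ha b hb => ⟨⟨?_, ?_⟩, ⟨?_, ?_⟩⟩
  · change Q.mul (Q.mul a b) p ∈ Q.psq I I
    rw [Q.mul_assoc]
    exact mul_mem_psq ha (h.mul_mem hb p)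
  · change Q.bracket (Q.mul a b) p ∈ Q.psq I I
    rw [Q.leibniz]
    exact add_mem (mul_mem_psq (h.bracket_mem ha p) hb) (mul_mem_psq ha (h.bracket_mem hb p))
  · change Q.mul (Q.bracket a b) p ∈ Q.psq I I
    rw [eq_sub_of_add_eq (Q.leibniz a p b).symm]
    exact sub_mem (bracket_mem_psq (h.mul_mem ha p) hb) (mul_mem_psq ha (h.bracket_mem' p hb))
  · change Q.bracket (Q.bracket a b) p ∈ Q.psq I I
    rw [Q.bracket_bracket]
    exact sub_mem (bracket_mem_psq ha (h.bracket_mem hb p))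
      (bracket_mem_psq hb (h.bracket_mem ha p))

theorem isIdeal_ders (h : Q.IsIdeal I) (n : ℕ) : Q.IsIdeal (Q.ders I n) := by
  induction n with
  | zero => exact h
  | succ n ih => exact Q.isIdeal_psq_self ih

theorem isIdeal_annih (h : Q.IsIdeal N) : Q.IsIdeal (Q.annih N) := by
  refine Q.isIdeal_of_right fun x hx p => ⟨fun b hb => ⟨?_, ?_⟩, fun b hb => ⟨?_, ?_⟩⟩
  · rw [Q.mul_assoc, (hx _ (h.mul_mem' p hb)).1]
  · rw [Q.leibniz, (hx b hb).2, (hx _ (h.bracket_mem' p hb)).1]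
    simp
  · rw [eq_sub_of_add_eq (Q.leibniz_right x p b).symm, (hx b hb).2, (hx _ (h.mul_mem' p hb)).2]
    simp
  · rw [Q.bracket_bracket, (hx b hb).2, (hx _ (h.bracket_mem' p hb)).2]
    simp

/-- An ideal annihilating `N` whose square lies in `N` is nilpotent. -/
theorem isNilpotentSub_of_le_annih (hI : I ≤ Q.annih N) (h : Q.psq I I ≤ N) :
    Q.IsNilpotentSub I := by
  refine ⟨2, le_bot_iff.1 <| psq_le.2 fun y hy b hb => ?_⟩
  have hb' := hI hb y (h hy)
  rw [Submodule.mem_bot, Submodule.mem_bot, Q.mul_comm, Q.bracket_skew, hb'.1, hb'.2]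
  simp

end PoissonAlgebra

/-- The annihilator of the nilradical `N` taken in the radical `R` is contained in `N`. -/
theorem ann_nilradical_in_radical {F P : Type*} [Field F] [AddCommGroup P] [Module F P]
    [FiniteDimensional F P] (Q : PoissonAlgebra F P) (R N : Submodule F P)
    (hR : Q.toDialgebra.IsRadical R) (hN : Q.toDialgebra.IsNilradical N) :
    ∀ x ∈ R, (∀ b ∈ N, Q.mul x b = 0 ∧ Q.bracket x b = 0) → x ∈ N := by
  intro x hxR hx
  have hC : Q.IsIdeal (R ⊓ Q.annih N) :=
    Q.isIdeal_of_right fun a ha p =>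
      ⟨⟨hR.1.mul_mem ha.1 p, (Q.isIdeal_annih hN.1).mul_mem ha.2 p⟩,
        ⟨hR.1.bracket_mem ha.1 p, (Q.isIdeal_annih hN.1).bracket_mem ha.2 p⟩⟩
  have descent : ∀ n, Q.ders (R ⊓ Q.annih N) n ≤ N → R ⊓ Q.annih N ≤ N := by
    intro n
    induction n with
    | zero => exact id
    | succ n ih =>
      intro h
      exact ih <| hN.2.2 _ (Q.isIdeal_ders hC n) <|
        Q.isNilpotentSub_of_le_annih ((hC.ders_le n).trans inf_le_right) h
  obtain ⟨n, hn⟩ := hR.2.1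
  exact descent n ((Dialgebra.ders_mono inf_le_left n).trans (hn.trans_le bot_le)) ⟨hxR, hx⟩
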